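/- arXiv:1605.00922 — 2 statements merged into one kernel-verified Lean document; each statement's English description precedes it below -/
import Mathlib

section
/- Let n ≥ 1 and 0 < p₀ = q₀ < ∞. Let 𝓕 be a family of pairs (f,g) of non-negative measurable functions on ℝⁿ, and suppose there is an increasing function N : (0,∞) → (0,∞) such that for every weight w ∈ RH_∞, every pair (f,g) ∈ 𝓕 with ‖f‖_{L^{p₀}(w)} < ∞ satisfies ‖f‖_{L^{p₀}(w)} ≤ N([w]_{RH_∞}) ‖g‖_{L^{p₀}(w)}. Then for every p with 0 < p ≤ q₀ there is a constant C, depending only on n, p, p₀ and N, such that for every (f,g) ∈ 𝓕 with ‖f‖_{L^p(ℝⁿ)} < ∞, one has ‖f‖_{L^p(ℝⁿ)} ≤ C ‖g‖_{L^p(ℝⁿ)} (with respect to Lebesgue measure). -/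
open MeasureTheory Filter
open scoped ENNReal Classical

noncomputable section

abbrev Rn (n : ℕ) := Fin n → ℝ

/-- A cube in `ℝⁿ` with sides parallel to the coordinate axes. -/
def IsCube {n : ℕ} (Q : Set (Rn n)) : Prop :=
  ∃ (c : Rn n) (h : ℝ), 0 < h ∧ Q = Set.univ.pi fun i => Set.Icc (c i) (c i + h)

/-- The average `⨍_Q f = |Q|⁻¹ ∫_Q f`. -/
def cubeAvg {n : ℕ} (Q : Set (Rn n)) (f : Rn n → ℝ) : ℝ :=
  (volume Q).toReal⁻¹ * ∫ x in Q, f x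

/-- A weight: a non-negative locally integrable function. -/
def IsWeight {n : ℕ} (w : Rn n → ℝ) : Prop :=
  (∀ x, 0 ≤ w x) ∧ LocallyIntegrable w volume

/-- Weighted `L^p` norm `(∫ |f|^p w)^{1/p}`. -/
def lpNorm {n : ℕ} (p : ℝ) (w : Rn n → ℝ) (f : Rn n → ℝ) : ℝ≥0∞ :=
  (∫⁻ x, ENNReal.ofReal (|f x| ^ p * w x)) ^ (1 / p)

/-- Weighted `L^p` norm of an `ℝ≥0∞`-valued function. -/
def elpNorm {n : ℕ} (p : ℝ) (w : Rn n → ℝ) (F : Rn n → ℝ≥0∞) : ℝ≥0∞ :=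
  (∫⁻ x, F x ^ p * ENNReal.ofReal (w x)) ^ (1 / p)

/-- A Young function: convex, increasing, continuous on `[0,∞)`, vanishing at `0`,
and superlinear at infinity. -/
def IsYoung (Φ : ℝ → ℝ) : Prop :=
  ConvexOn ℝ (Set.Ici 0) Φ ∧ StrictMonoOn Φ (Set.Ici 0) ∧ ContinuousOn Φ (Set.Ici 0) ∧
    Φ 0 = 0 ∧ Tendsto (fun t => Φ t / t) atTop atTop

/-- The complementary Young function `Φ̄(s) = sup_{t ≥ 0} (st - Φ(t))`. -/
def youngConj (Φ : ℝ → ℝ) (s : ℝ) : ℝ :=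
  sSup {r : ℝ | ∃ t : ℝ, 0 ≤ t ∧ r = s * t - Φ t}

/-- Generalized inverse `Φ⁻¹(t) = inf {s ≥ 0 : Φ(s) ≥ t}`. -/
def youngInv (Φ : ℝ → ℝ) (t : ℝ) : ℝ := sInf {s : ℝ | 0 ≤ s ∧ t ≤ Φ s}

/-- The `B_p` condition: `∫₁^∞ Ψ(t)/t^p dt/t < ∞`. -/
def BClass (p : ℝ) (Ψ : ℝ → ℝ) : Prop :=
  ∫⁻ t in Set.Ioi (1 : ℝ), ENNReal.ofReal (Ψ t / t ^ p / t) < ⊤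

/-- The conjugate exponent `r' = r/(r-1)`. -/
def conjExp (r : ℝ) : ℝ := r / (r - 1)

/-- The localized Orlicz norm `‖f‖_{Φ,Q}`. -/
def orliczNorm {n : ℕ} (Φ : ℝ → ℝ) (f : Rn n → ℝ) (Q : Set (Rn n)) : ℝ :=
  sInf {lam : ℝ | 0 < lam ∧ cubeAvg Q (fun x => Φ (|f x| / lam)) ≤ 1}

/-- `w ∈ RH_Ψ` with constant `c`: `‖w‖_{Ψ,Q} ≤ c ⨍_Q w` for all cubes `Q`. -/
def RHOrliczWith {n : ℕ} (Ψ : ℝ → ℝ) (w : Rn n → ℝ) (c : ℝ) : Prop :=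
  ∀ Q : Set (Rn n), IsCube Q → orliczNorm Ψ w Q ≤ c * cubeAvg Q w

/-- The generalized reverse Hölder class `RH_Ψ`. -/
def RHOrlicz {n : ℕ} (Ψ : ℝ → ℝ) (w : Rn n → ℝ) : Prop :=
  ∃ c : ℝ, RHOrliczWith Ψ w c

/-- `w ∈ RH_s` with constant `c`. -/
def RHWith {n : ℕ} (s : ℝ) (w : Rn n → ℝ) (c : ℝ) : Prop :=
  ∀ Q : Set (Rn n), IsCube Q →
    (cubeAvg Q fun x => w x ^ s) ^ (1 / s) ≤ c * cubeAvg Q w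

/-- `w ∈ RH_∞` with constant `c`: `ess sup_Q w ≤ c ⨍_Q w` for all cubes `Q`. -/
def RHInftyWith {n : ℕ} (w : Rn n → ℝ) (c : ℝ) : Prop :=
  ∀ Q : Set (Rn n), IsCube Q →
    essSup (fun x => ENNReal.ofReal (w x)) (volume.restrict Q)
      ≤ ENNReal.ofReal (c * cubeAvg Q w)

/-- `w ∈ RH_{(q₀/p)'}` with constant `c`, with the convention that this means `RH_∞`
when `p = q₀`. -/
def RHConjWith {n : ℕ} (q₀ p : ℝ) (w : Rn n → ℝ) (c : ℝ) : Prop :=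
  if p = q₀ then RHInftyWith w c else RHWith (conjExp (q₀ / p)) w c

/-- The Orlicz maximal operator `M_Ψ f(x) = sup_{Q ∋ x} ‖f‖_{Ψ,Q}` (`ℝ≥0∞`-valued). -/
def orliczMax {n : ℕ} (Ψ : ℝ → ℝ) (f : Rn n → ℝ) (x : Rn n) : ℝ≥0∞ :=
  ⨆ (Q : Set (Rn n)) (_ : IsCube Q ∧ x ∈ Q), ENNReal.ofReal (orliczNorm Ψ f Q)



/-- Bounded and compactly supported. -/
def IsBddCS {n : ℕ} (f : Rn n → ℝ) : Prop :=
  (∃ M : ℝ, ∀ x, |f x| ≤ M) ∧ HasCompactSupport f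

/-- A Calderón–Zygmund operator. -/
def IsCZO {n : ℕ} (T : (Rn n → ℝ) → Rn n → ℝ) : Prop :=
  (∀ f g : Rn n → ℝ, T (f + g) = T f + T g) ∧
  (∀ (c : ℝ) (f : Rn n → ℝ), T (c • f) = c • T f) ∧
  (∃ C : ℝ, 0 < C ∧ ∀ f : Rn n → ℝ, MemLp f 2 volume →
      eLpNorm (T f) 2 volume ≤ ENNReal.ofReal C * eLpNorm f 2 volume) ∧
  ∃ (K : Rn n → Rn n → ℝ) (C₀ ε : ℝ), 0 < C₀ ∧ 0 < ε ∧
    (∀ x y : Rn n, x ≠ y → |K x y| ≤ C₀ * ‖x - y‖ ^ (-(n : ℝ))) ∧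
    (∀ x y h : Rn n, 2 * ‖h‖ < ‖x - y‖ →
      |K x y - K x (y + h)| + |K x y - K (x + h) y|
        ≤ C₀ * ‖h‖ ^ ε * ‖x - y‖ ^ (-(n : ℝ) - ε)) ∧
    ∀ f : Rn n → ℝ, IsBddCS f →
      ∀ᵐ x, x ∉ tsupport f → T f x = ∫ y, K x y * f y

/-- A bilinear Calderón–Zygmund operator. -/
def IsBilinearCZO {n : ℕ} (T : (Rn n → ℝ) → (Rn n → ℝ) → Rn n → ℝ) : Prop :=
  (∀ f₁ f₂ g : Rn n → ℝ, T (f₁ + f₂) g = T f₁ g + T f₂ g) ∧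
  (∀ (f g₁ g₂ : Rn n → ℝ), T f (g₁ + g₂) = T f g₁ + T f g₂) ∧
  (∀ (c : ℝ) (f g : Rn n → ℝ), T (c • f) g = c • T f g) ∧
  (∀ (c : ℝ) (f g : Rn n → ℝ), T f (c • g) = c • T f g) ∧
  (∃ C : ℝ, 0 < C ∧ ∀ f g : Rn n → ℝ, MemLp f 2 volume → MemLp g 2 volume →
      eLpNorm (T f g) 1 volume ≤ ENNReal.ofReal C * (eLpNorm f 2 volume * eLpNorm g 2 volume)) ∧
  ∃ (K : Rn n → Rn n → Rn n → ℝ) (C₀ : ℝ), 0 < C₀ ∧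
    (∀ x y z : Rn n, ¬(y = x ∧ z = x) →
      |K x y z| ≤ C₀ * (‖x - y‖ + ‖x - z‖) ^ (-(2 * (n : ℝ)))) ∧
    (∀ x y z : Rn n, ¬(y = x ∧ z = x) →
      ‖fderiv ℝ (fun q : Rn n × Rn n × Rn n => K q.1 q.2.1 q.2.2) (x, y, z)‖
        ≤ C₀ * (‖x - y‖ + ‖x - z‖) ^ (-(2 * (n : ℝ)) - 1)) ∧
    ∀ f g : Rn n → ℝ, IsBddCS f → IsBddCS g →
      ∀ᵐ x, x ∉ tsupport f ∩ tsupport g →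
        T f g x = ∫ q : Rn n × Rn n, K x q.1 q.2 * f q.1 * g q.2

/-- The bisublinear Orlicz maximal operator. -/
def biOrliczMax {n : ℕ} (Ψ₁ Ψ₂ : ℝ → ℝ) (f g : Rn n → ℝ) (x : Rn n) : ℝ≥0∞ :=
  ⨆ (Q : Set (Rn n)) (_ : IsCube Q ∧ x ∈ Q),
    ENNReal.ofReal (orliczNorm Ψ₁ f Q * orliczNorm Ψ₂ g Q)

/-- The bilinear fractional integral operator. -/
def BIalpha {n : ℕ} (α : ℝ) (f g : Rn n → ℝ) (x : Rn n) : ℝ≥0∞ :=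
  ∫⁻ y, ENNReal.ofReal (f (x - y) * g (x + y) * ‖y‖ ^ (α - (n : ℝ)))

/-- The bisublinear fractional maximal operator `𝓜_α`. -/
def biFracMax {n : ℕ} (α : ℝ) (f g : Rn n → ℝ) (x : Rn n) : ℝ≥0∞ :=
  ⨆ (Q : Set (Rn n)) (_ : IsCube Q ∧ x ∈ Q),
    ENNReal.ofReal ((volume Q).toReal ^ (α / (n : ℝ)) *
      cubeAvg Q (fun y => |f y|) * cubeAvg Q (fun z => |g z|))

/-- A dyadic grid, given by its generations `D k`. -/
def IsDyadicGrid {n : ℕ} (D : ℤ → Set (Set (Rn n))) : Prop :=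
  (∀ k : ℤ, ∀ Q ∈ D k, ∃ c : Rn n,
      Q = Set.univ.pi fun i => Set.Ico (c i) (c i + (2 : ℝ) ^ (-k))) ∧
  (∀ k : ℤ, ⋃₀ D k = Set.univ) ∧
  (∀ k : ℤ, (D k).PairwiseDisjoint id) ∧
  (∀ P Q : Set (Rn n), (∃ k, P ∈ D k) → (∃ k, Q ∈ D k) →
    P ∩ Q = ∅ ∨ P ⊆ Q ∨ Q ⊆ P)

/-- A sparse family of cubes. -/
def IsSparse {n : ℕ} (S : Set (Set (Rn n))) : Prop :=
  ∀ Q ∈ S, volume (⋃ Q' ∈ {Q' | Q' ∈ S ∧ Q' ⊂ Q}, Q') ≤ volume Q / 2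

/-- The sparse operator `T^𝒮 f = Σ_{Q ∈ 𝒮} (⨍_Q f) χ_Q`. -/
def sparseOp {n : ℕ} (S : Set (Set (Rn n))) (f : Rn n → ℝ) (x : Rn n) : ℝ≥0∞ :=
  ∑' Q : S, Set.indicator (Q : Set (Rn n)) (fun _ => ENNReal.ofReal (cubeAvg (Q : Set (Rn n)) f)) x

/-- The bilinear sparse operator. -/
def sparseOp2 {n : ℕ} (S : Set (Set (Rn n))) (f g : Rn n → ℝ) (x : Rn n) : ℝ≥0∞ :=
  ∑' Q : S, Set.indicator (Q : Set (Rn n))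
    (fun _ => ENNReal.ofReal (cubeAvg (Q : Set (Rn n)) f * cubeAvg (Q : Set (Rn n)) g)) x

/-- `w ∈ A_p` with constant `c`. -/
def ApWith {n : ℕ} (p : ℝ) (w : Rn n → ℝ) (c : ℝ) : Prop :=
  ∀ Q : Set (Rn n), IsCube Q →
    cubeAvg Q w * (cubeAvg Q fun x => w x ^ (1 - conjExp p)) ^ (p - 1) ≤ c

/-- `H ∈ A₁` with constant `c`: `⨍_Q H ≤ c H(x)` for a.e. `x ∈ Q`. -/
def A1With {n : ℕ} (H : Rn n → ℝ) (c : ℝ) : Prop :=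
  ∀ Q : Set (Rn n), IsCube Q →
    ∀ᵐ x ∂(volume.restrict Q), cubeAvg Q H ≤ c * H x

/-- Real-valued Orlicz maximal operator. -/
def orliczMaxR {n : ℕ} (Ψ : ℝ → ℝ) (f : Rn n → ℝ) (x : Rn n) : ℝ :=
  sSup {r : ℝ | ∃ Q : Set (Rn n), IsCube Q ∧ x ∈ Q ∧ r = orliczNorm Ψ f Q}

/-- Iterates of the Orlicz maximal operator. -/
def iterM {n : ℕ} (Ψ : ℝ → ℝ) (h : Rn n → ℝ) : ℕ → Rn n → ℝ
  | 0 => h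
  | k + 1 => orliczMaxR Ψ (iterM Ψ h k)

/-- The Rubio de Francia iteration `𝓡h = Σ_k M^k h / (2^k ‖M‖^k)`. -/
def RdF {n : ℕ} (Ψ : ℝ → ℝ) (Mnorm : ℝ) (h : Rn n → ℝ) (x : Rn n) : ℝ :=
  ∑' k : ℕ, iterM Ψ h k x / (2 ^ k * Mnorm ^ k)

/-- Uncentred maximal function over open sup-norm balls. -/
def MM {n : ℕ} (f : Rn n → ℝ≥0∞) (x : Rn n) : ℝ≥0∞ :=
  ⨆ (i : Rn n × ℝ) (_ : x ∈ Metric.ball i.1 i.2),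
    (∫⁻ y in Metric.ball i.1 i.2, f y) / volume (Metric.ball i.1 i.2)

lemma lt_MM_iff {n : ℕ} (f : Rn n → ℝ≥0∞) (x : Rn n) (l : ℝ≥0∞) :
    l < MM f x ↔ ∃ i : Rn n × ℝ, x ∈ Metric.ball i.1 i.2 ∧
      l < (∫⁻ y in Metric.ball i.1 i.2, f y) / volume (Metric.ball i.1 i.2) := by
  simp only [MM, lt_iSup_iff, exists_prop]

lemma measurable_MM {n : ℕ} (f : Rn n → ℝ≥0∞) : Measurable (MM f) := by
  apply LowerSemicontinuous.measurable
  intro x l hl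
  obtain ⟨i, hi, h⟩ := (lt_MM_iff f x l).1 hl
  filter_upwards [Metric.isOpen_ball.mem_nhds hi] with y hy
  exact (lt_MM_iff f y l).2 ⟨i, hy, h⟩

lemma weak_MM {n : ℕ} (hn : 1 ≤ n) (f : Rn n → ℝ≥0∞) (l : ℝ≥0∞) :
    l * volume {x | l < MM f x} ≤ 5 ^ n * ∫⁻ x, f x := by
  by_cases hl : l = 0
  · simp [hl]
  by_cases hI : ∫⁻ x, f x = ∞
  · rw [hI, ENNReal.mul_top (by positivity)]; exact le_top
  set t : Set (Rn n × ℝ) := {i | 0 < i.2 ∧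
    l * volume (Metric.ball i.1 i.2) ≤ ∫⁻ y in Metric.ball i.1 i.2, f y} with ht
  have hsub : {x | l < MM f x} ⊆ ⋃ i ∈ t, Metric.closedBall i.1 i.2 := by
    intro x hx
    obtain ⟨i, hi, h⟩ := (lt_MM_iff f x l).1 hx
    have hpos : 0 < i.2 := Metric.pos_of_mem_ball hi
    refine Set.mem_biUnion (x := i) ⟨hpos, ?_⟩ (Metric.ball_subset_closedBall hi)
    exact ENNReal.mul_le_of_le_div h.le
  have hR : ∀ i ∈ t, i.2 ≤ 1 + ((∫⁻ x, f x) / l).toReal := by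
    rintro i ⟨hi, h⟩
    have h1 : ENNReal.ofReal ((2 * i.2) ^ n) ≤ (∫⁻ x, f x) / l := by
      rw [ENNReal.le_div_iff_mul_le (Or.inl hl) (Or.inr hI), mul_comm]
      have := Real.volume_pi_ball i.1 hi
      rw [Fintype.card_fin] at this
      rw [← this]
      exact h.trans (setLIntegral_le_lintegral _ _)
    rw [ENNReal.ofReal_le_iff_le_toReal (ENNReal.div_ne_top hI hl)] at h1
    by_cases h2 : 2 * i.2 ≤ 1
    · have : 0 ≤ ((∫⁻ x, f x) / l).toReal := ENNReal.toReal_nonneg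
      linarith
    · have := le_self_pow₀ (le_of_not_ge h2) (show n ≠ 0 by omega)
      linarith
  obtain ⟨u, hut, hdisj, hcov⟩ :=
    Vitali.exists_disjoint_subfamily_covering_enlargement_closedBall t (fun i => i.1)
      (fun i => i.2) _ hR 5 (by norm_num)
  have hdisj' : u.PairwiseDisjoint fun i => Metric.ball i.1 i.2 :=
    hdisj.mono fun i => Metric.ball_subset_closedBall
  have hc : u.Countable := by
    apply hdisj'.countable_of_nonempty_interior
    intro i hi
    rw [Metric.isOpen_ball.interior_eq]
    exact Metric.nonempty_ball.2 (hut hi).1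
  have hsub2 : {x | l < MM f x} ⊆ ⋃ i ∈ u, Metric.closedBall i.1 (5 * i.2) := by
    intro x hx
    obtain ⟨i, hi, hxi⟩ := Set.mem_iUnion₂.1 (hsub hx)
    obtain ⟨j, hj, hij⟩ := hcov i hi
    exact Set.mem_biUnion hj (hij hxi)
  have key : ∀ i : u, l * volume (Metric.closedBall (i : Rn n × ℝ).1 (5 * (i : Rn n × ℝ).2)) ≤
      5 ^ n * ∫⁻ y in Metric.ball (i : Rn n × ℝ).1 (i : Rn n × ℝ).2, f y := by
    rintro ⟨i, hi⟩
    obtain ⟨hpos, h⟩ := hut hi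
    have e1 := Real.volume_pi_ball i.1 hpos
    have e2 := Real.volume_pi_closedBall i.1 (show 0 ≤ 5 * i.2 by positivity)
    rw [Fintype.card_fin] at e1 e2
    have e3 : volume (Metric.closedBall i.1 (5 * i.2)) = 5 ^ n * volume (Metric.ball i.1 i.2) := by
      rw [e1, e2, show (2 * (5 * i.2)) ^ n = 5 ^ n * (2 * i.2) ^ n by rw [← mul_pow]; ring,
        ENNReal.ofReal_mul (by positivity), ENNReal.ofReal_pow (by norm_num)]
      norm_num
    simp only [e3]
    calc l * (5 ^ n * volume (Metric.ball i.1 i.2))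
        = 5 ^ n * (l * volume (Metric.ball i.1 i.2)) := by ring
      _ ≤ _ := by gcongr
  calc l * volume {x | l < MM f x}
      ≤ l * ∑' i : u, volume (Metric.closedBall (i : Rn n × ℝ).1 (5 * (i : Rn n × ℝ).2)) := by
        gcongr
        exact (measure_mono hsub2).trans (measure_biUnion_le _ hc _)
    _ = ∑' i : u, l * volume (Metric.closedBall (i : Rn n × ℝ).1 (5 * (i : Rn n × ℝ).2)) :=
        ENNReal.tsum_mul_left.symm
    _ ≤ ∑' i : u, 5 ^ n * ∫⁻ y in Metric.ball (i : Rn n × ℝ).1 (i : Rn n × ℝ).2, f y :=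
        ENNReal.tsum_le_tsum key
    _ = 5 ^ n * ∑' i : u, ∫⁻ y in Metric.ball (i : Rn n × ℝ).1 (i : Rn n × ℝ).2, f y :=
        ENNReal.tsum_mul_left
    _ ≤ 5 ^ n * ∫⁻ x, f x := by
        gcongr
        rw [← lintegral_biUnion hc (fun i _ => measurableSet_ball) hdisj']
        exact setLIntegral_le_lintegral _ _

lemma MM_le_add {n : ℕ} (f g : Rn n → ℝ≥0∞) (hg : Measurable g) (l : ℝ≥0∞)
    (h : ∀ x, f x ≤ g x + l) (x : Rn n) : MM f x ≤ MM g x + l := by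
  refine iSup₂_le fun i hi => ?_
  have hpos : 0 < i.2 := Metric.pos_of_mem_ball hi
  calc _ ≤ (∫⁻ y in Metric.ball i.1 i.2, (g y + l)) / volume (Metric.ball i.1 i.2) := by
        gcongr with y; exact h y
    _ = (∫⁻ y in Metric.ball i.1 i.2, g y) / volume (Metric.ball i.1 i.2)
        + l * volume (Metric.ball i.1 i.2) / volume (Metric.ball i.1 i.2) := by
        rw [lintegral_add_left hg, setLIntegral_const, ENNReal.add_div]
    _ ≤ MM g x + l := by
        gcongr
        · exact le_iSup₂_of_le (f := fun (i : Rn n × ℝ) (_ : x ∈ Metric.ball i.1 i.2) =>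
            (∫⁻ y in Metric.ball i.1 i.2, g y) / volume (Metric.ball i.1 i.2)) i hi le_rfl
        · exact ENNReal.div_le_of_le_mul le_rfl

lemma MM_tsum_le {n : ℕ} (f : ℕ → Rn n → ℝ≥0∞) (hf : ∀ k, Measurable (f k)) (x : Rn n) :
    MM (fun y => ∑' k, f k y) x ≤ ∑' k, MM (f k) x := by
  refine iSup₂_le fun i hi => ?_
  rw [lintegral_tsum (fun k => (hf k).aemeasurable), div_eq_mul_inv, ← ENNReal.tsum_mul_right]
  refine ENNReal.tsum_le_tsum fun k => ?_
  rw [← div_eq_mul_inv]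
  exact le_iSup₂_of_le (f := fun (i : Rn n × ℝ) (_ : x ∈ Metric.ball i.1 i.2) =>
            (∫⁻ y in Metric.ball i.1 i.2, f k y) / volume (Metric.ball i.1 i.2)) i hi le_rfl

lemma MM_const_mul {n : ℕ} (f : Rn n → ℝ≥0∞) (hf : Measurable f) (c : ℝ≥0∞) (x : Rn n) :
    MM (fun y => c * f y) x = c * MM f x := by
  simp only [MM, ENNReal.mul_iSup, lintegral_const_mul c hf, mul_div_assoc]

lemma sq_le_layer (y : ℝ≥0∞) :
    y ^ 2 ≤ ∫⁻ t in Set.Ioi (0 : ℝ), if ENNReal.ofReal t < y then ENNReal.ofReal (2 * t) else 0 := by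
  have hfin : ∀ a : ℝ, 0 ≤ a → ENNReal.ofReal a ≤ y →
      ENNReal.ofReal a ^ 2 ≤ ∫⁻ t in Set.Ioi (0 : ℝ),
        if ENNReal.ofReal t < y then ENNReal.ofReal (2 * t) else 0 := by
    intro a ha hay
    have h1 : ENNReal.ofReal a ^ 2 = ∫⁻ t in Set.Ioo (0 : ℝ) a, ENNReal.ofReal (2 * t) := by
      rw [← ofReal_integral_eq_lintegral_ofReal]
      · rw [← integral_Ioc_eq_integral_Ioo, ← intervalIntegral.integral_of_le ha,
          intervalIntegral.integral_const_mul, integral_id, ← ENNReal.ofReal_pow ha]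
        congr 1; ring
      · have : IntegrableOn (fun t : ℝ => 2 * t) (Set.Icc 0 a) :=
          (by fun_prop : Continuous fun t : ℝ => 2 * t).continuousOn.integrableOn_Icc
        exact this.mono_set Set.Ioo_subset_Icc_self
      · filter_upwards [ae_restrict_mem measurableSet_Ioo] with t ht
        have := ht.1
        simp; linarith
    rw [h1]
    calc _ = ∫⁻ t in Set.Ioo (0 : ℝ) a,
              if ENNReal.ofReal t < y then ENNReal.ofReal (2 * t) else 0 := by
          apply setLIntegral_congr_fun measurableSet_Ioo
          intro t ht
          have : ENNReal.ofReal t < y :=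
            ((ENNReal.ofReal_lt_ofReal_iff (ht.1.trans ht.2)).2 ht.2).trans_le hay
          simp [this]
      _ ≤ _ := lintegral_mono_set Set.Ioo_subset_Ioi_self
  by_cases hy : y = ∞
  · refine le_of_forall_lt fun b hb => ?_
    have hb' : b ≠ ∞ := (lt_of_lt_of_le hb le_top).ne
    have h2 := hfin (b.toReal + 1) (by positivity) (by rw [hy]; exact le_top)
    refine lt_of_lt_of_le ?_ h2
    rw [ENNReal.ofReal_add (by positivity) (by norm_num), ENNReal.ofReal_toReal hb',
      ENNReal.ofReal_one]
    have : b < b + 1 := ENNReal.lt_add_right hb' one_ne_zero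
    refine this.trans_le ?_
    exact le_self_pow₀ (by simp) (by norm_num)
  · have := hfin y.toReal (by positivity) (by rw [ENNReal.ofReal_toReal hy])
    rwa [ENNReal.ofReal_toReal hy] at this

lemma layer_le (y : ℝ≥0∞) :
    ∫⁻ t in Set.Ioi (0 : ℝ), (if ENNReal.ofReal (t / 2) < y then (1 : ℝ≥0∞) else 0) ≤ 2 * y := by
  by_cases hy : y = ∞
  · simp [hy]
  calc _ ≤ ∫⁻ t in Set.Ioi (0 : ℝ), (Set.Ioo 0 (2 * y.toReal)).indicator 1 t := by
        apply setLIntegral_mono' measurableSet_Ioi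
        intro t ht
        split_ifs with h
        · rw [Set.indicator_of_mem]
          · simp
          refine ⟨ht, ?_⟩
          rw [ENNReal.ofReal_lt_iff_lt_toReal (by have : 0 < t := ht; positivity) hy] at h
          linarith
        · simp
    _ ≤ ∫⁻ t, (Set.Ioo 0 (2 * y.toReal)).indicator 1 t := setLIntegral_le_lintegral _ _
    _ = volume (Set.Ioo 0 (2 * y.toReal)) := lintegral_indicator_one measurableSet_Ioo
    _ ≤ 2 * y := by
        rw [Real.volume_Ioo, sub_zero, ENNReal.ofReal_mul (by norm_num), ENNReal.ofReal_toReal hy]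
        simp

lemma strong_MM {n : ℕ} (hn : 1 ≤ n) (f : Rn n → ℝ≥0∞) (hf : Measurable f) :
    ∫⁻ x, MM f x ^ 2 ≤ 8 * 5 ^ n * ∫⁻ x, f x ^ 2 := by
  have hM := measurable_MM f
  have step : ∀ t : ℝ, 0 < t → ENNReal.ofReal (2 * t) * volume {x | ENNReal.ofReal t < MM f x} ≤
      4 * 5 ^ n * ∫⁻ x, if ENNReal.ofReal (t / 2) < f x then f x else 0 := by
    intro t ht
    set g : Rn n → ℝ≥0∞ := fun x => if ENNReal.ofReal (t / 2) < f x then f x else 0 with hg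
    have hgm : Measurable g :=
      Measurable.ite (measurableSet_lt measurable_const hf) hf measurable_const
    have h1 : ∀ x, f x ≤ g x + ENNReal.ofReal (t / 2) := by
      intro x
      by_cases h : ENNReal.ofReal (t / 2) < f x
      · simp [hg, h]
      · simp [hg, h, not_lt.1 h]
    have h2 : {x | ENNReal.ofReal t < MM f x} ⊆ {x | ENNReal.ofReal (t / 2) < MM g x} := by
      intro x hx
      have h3 := lt_of_lt_of_le hx (MM_le_add f g hgm _ h1 x)
      have h4 : ENNReal.ofReal t = ENNReal.ofReal (t / 2) + ENNReal.ofReal (t / 2) := by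
        rw [← ENNReal.ofReal_add (by positivity) (by positivity)]; congr 1; ring
      rw [h4] at h3
      exact lt_of_add_lt_add_right h3
    have h5 : ENNReal.ofReal (2 * t) = 4 * ENNReal.ofReal (t / 2) := by
      rw [show (2 * t) = 4 * (t / 2) by ring, ENNReal.ofReal_mul (by norm_num)]; norm_num
    calc _ ≤ 4 * ENNReal.ofReal (t / 2) * volume {x | ENNReal.ofReal (t / 2) < MM g x} := by
          rw [h5]; gcongr
      _ = 4 * (ENNReal.ofReal (t / 2) * volume {x | ENNReal.ofReal (t / 2) < MM g x}) := by ring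
      _ ≤ 4 * (5 ^ n * ∫⁻ x, g x) := mul_le_mul_right (weak_MM hn g _) 4
      _ = _ := by ring
  calc ∫⁻ x, MM f x ^ 2
      ≤ ∫⁻ x, ∫⁻ t in Set.Ioi (0 : ℝ),
          if ENNReal.ofReal t < MM f x then ENNReal.ofReal (2 * t) else 0 :=
        lintegral_mono fun x => sq_le_layer _
    _ = ∫⁻ t in Set.Ioi (0 : ℝ), ∫⁻ x,
          if ENNReal.ofReal t < MM f x then ENNReal.ofReal (2 * t) else 0 := by
        apply lintegral_lintegral_swap
        apply Measurable.aemeasurable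
        exact Measurable.ite (measurableSet_lt (by fun_prop) (by fun_prop))
          (by fun_prop) measurable_const
    _ ≤ ∫⁻ t in Set.Ioi (0 : ℝ),
          4 * 5 ^ n * ∫⁻ x, if ENNReal.ofReal (t / 2) < f x then f x else 0 := by
        apply setLIntegral_mono' measurableSet_Ioi
        intro t ht
        refine le_trans (le_of_eq ?_) (step t ht)
        have := lintegral_indicator_const (μ := (volume : Measure (Rn n)))
          (measurableSet_lt measurable_const hM : MeasurableSet {x | ENNReal.ofReal t < MM f x})
          (ENNReal.ofReal (2 * t))
        rw [← this]
        apply lintegral_congr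
        intro x
        simp only [Set.indicator, Set.mem_ofPred_eq]
    _ = 4 * 5 ^ n * ∫⁻ t in Set.Ioi (0 : ℝ),
          ∫⁻ x, if ENNReal.ofReal (t / 2) < f x then f x else 0 := by
        rw [lintegral_const_mul']
        exact ENNReal.mul_ne_top (by norm_num) (by simp)
    _ = 4 * 5 ^ n * ∫⁻ x, ∫⁻ t in Set.Ioi (0 : ℝ),
          if ENNReal.ofReal (t / 2) < f x then f x else 0 := by
        congr 1
        apply lintegral_lintegral_swap
        apply Measurable.aemeasurable
        exact Measurable.ite (measurableSet_lt (by fun_prop) (by fun_prop))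
          (by fun_prop) measurable_const
    _ ≤ 4 * 5 ^ n * ∫⁻ x, 2 * f x ^ 2 := by
        gcongr with x
        have hm : Measurable fun t : ℝ => if ENNReal.ofReal (t / 2) < f x then (1 : ℝ≥0∞) else 0 :=
          Measurable.ite (measurableSet_lt (by fun_prop) (by fun_prop))
            measurable_const measurable_const
        calc _ = ∫⁻ t in Set.Ioi (0 : ℝ), f x *
                (if ENNReal.ofReal (t / 2) < f x then (1 : ℝ≥0∞) else 0) := by simp
          _ = f x * ∫⁻ t in Set.Ioi (0 : ℝ),
                (if ENNReal.ofReal (t / 2) < f x then (1 : ℝ≥0∞) else 0) := by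
              rw [lintegral_const_mul _ hm]
          _ ≤ f x * (2 * f x) := by gcongr; exact layer_le _
          _ = _ := by ring
    _ = _ := by
        rw [lintegral_const_mul _ (by fun_prop)]; ring

lemma ennreal_cs (a b : ℕ → ℝ≥0∞) :
    (∑' k, a k * b k) ^ 2 ≤ (∑' k, a k ^ 2) * ∑' k, b k ^ 2 := by
  have h := ENNReal.lintegral_mul_le_Lp_mul_Lq (Measure.count : Measure ℕ)
    (Real.HolderConjugate.two_two) (f := a) (g := b)
    (measurable_of_countable _).aemeasurable (measurable_of_countable _).aemeasurable
  simp only [lintegral_count, Pi.mul_apply, ENNReal.rpow_ofNat] at h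
  calc _ ≤ _ := pow_le_pow_left' h 2
    _ = _ := by
      rw [mul_pow, ← ENNReal.rpow_natCast, ← ENNReal.rpow_natCast, ← ENNReal.rpow_mul,
        ← ENNReal.rpow_mul]
      norm_num

/-- Iterated maximal function. -/
def MMit {n : ℕ} (f : Rn n → ℝ≥0∞) : ℕ → Rn n → ℝ≥0∞
  | 0 => f
  | k + 1 => MM (MMit f k)

lemma measurable_MMit {n : ℕ} (f : Rn n → ℝ≥0∞) (hf : Measurable f) (k : ℕ) :
    Measurable (MMit f k) := by
  cases k with
  | zero => exact hf
  | succ k => exact measurable_MM _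

lemma strong_MMit {n : ℕ} (hn : 1 ≤ n) (f : Rn n → ℝ≥0∞) (hf : Measurable f) (k : ℕ) :
    ∫⁻ x, MMit f k x ^ 2 ≤ (8 * 5 ^ n) ^ k * ∫⁻ x, f x ^ 2 := by
  induction k with
  | zero => simp [MMit]
  | succ k ih =>
    calc _ ≤ 8 * 5 ^ n * ∫⁻ x, MMit f k x ^ 2 := strong_MM hn _ (measurable_MMit f hf k)
      _ ≤ 8 * 5 ^ n * ((8 * 5 ^ n) ^ k * ∫⁻ x, f x ^ 2) := by gcongr
      _ = _ := by ring

lemma exists_rdf {n : ℕ} (hn : 1 ≤ n) (f : Rn n → ℝ≥0∞) (hf : Measurable f) :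
    ∃ G : Rn n → ℝ≥0∞, Measurable G ∧ (∀ x, f x ≤ G x) ∧
      (∀ x, MM G x ≤ 8 * 5 ^ n * G x) ∧ ∫⁻ x, G x ^ 2 ≤ 4 * ∫⁻ x, f x ^ 2 := by
  set B : ℝ≥0∞ := 8 * 5 ^ n with hB
  have hB0 : B ≠ 0 := by positivity
  have hBt : B ≠ ∞ := ENNReal.mul_ne_top (by norm_num) (by simp)
  have hB8 : 8 ≤ B := by
    rw [hB]
    calc (8 : ℝ≥0∞) = 8 * 1 := by simp
      _ ≤ _ := by gcongr; exact one_le_pow₀ (by norm_num)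
  have hm := measurable_MMit f hf
  refine ⟨fun x => ∑' k, B⁻¹ ^ k * MMit f k x, ?_, ?_, ?_, ?_⟩
  · exact Measurable.tsum fun k => (hm k).const_mul _
  · intro x
    refine le_trans ?_ (ENNReal.le_tsum 0)
    simp [MMit]
  · intro x
    refine (MM_tsum_le _ (fun k => (hm k).const_mul _) x).trans ?_
    calc ∑' k, MM (fun y => B⁻¹ ^ k * MMit f k y) x
        = ∑' k, B * (B⁻¹ ^ (k + 1) * MMit f (k + 1) x) := by
          congr 1; ext k
          rw [MM_const_mul _ (hm k), pow_succ']
          rw [← mul_assoc, ← mul_assoc, ENNReal.mul_inv_cancel hB0 hBt, one_mul]; rfl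
      _ = B * ∑' k, B⁻¹ ^ (k + 1) * MMit f (k + 1) x := ENNReal.tsum_mul_left
      _ ≤ _ := by
          gcongr
          exact ENNReal.tsum_comp_le_tsum_of_injective (add_left_injective 1)
            (fun k => B⁻¹ ^ k * MMit f k x)
  · have hgeo : ∑' k : ℕ, (2⁻¹ : ℝ≥0∞) ^ k = 2 := by
      rw [ENNReal.tsum_geometric, ENNReal.one_sub_inv_two, inv_inv]
    have hpt : ∀ x, (∑' k, B⁻¹ ^ k * MMit f k x) ^ 2 ≤
        2 * ∑' k, (4 * B⁻¹ ^ 2) ^ k * MMit f k x ^ 2 := by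
      intro x
      have h := ennreal_cs (fun k => 2⁻¹ ^ k) (fun k => (2 * B⁻¹) ^ k * MMit f k x)
      have e1 : ∀ k : ℕ, (2⁻¹ : ℝ≥0∞) ^ k * ((2 * B⁻¹) ^ k * MMit f k x) = B⁻¹ ^ k * MMit f k x := by
        intro k
        rw [← mul_assoc, ← mul_pow, ← mul_assoc, ENNReal.inv_mul_cancel (by norm_num) (by norm_num),
          one_mul]
      have e2 : ∀ k : ℕ, ((2 * B⁻¹) ^ k * MMit f k x) ^ 2 = (4 * B⁻¹ ^ 2) ^ k * MMit f k x ^ 2 := by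
        intro k
        rw [mul_pow, ← pow_mul, mul_comm k 2, pow_mul, mul_pow]; norm_num
      simp only [e1, e2] at h
      refine h.trans ?_
      gcongr
      refine le_trans (ENNReal.tsum_le_tsum fun k => ?_) hgeo.le
      rw [← pow_mul]
      exact pow_le_pow_right_of_le_one' (ENNReal.inv_le_one.2 one_le_two) (by omega)
    calc ∫⁻ x, (∑' k, B⁻¹ ^ k * MMit f k x) ^ 2
        ≤ ∫⁻ x, 2 * ∑' k, (4 * B⁻¹ ^ 2) ^ k * MMit f k x ^ 2 := lintegral_mono hpt
      _ = 2 * ∑' k, (4 * B⁻¹ ^ 2) ^ k * ∫⁻ x, MMit f k x ^ 2 := by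
          rw [lintegral_const_mul' _ _ (by norm_num),
            lintegral_tsum (fun k => (((hm k).pow_const 2).const_mul _).aemeasurable)]
          congr 2; ext k
          rw [lintegral_const_mul _ ((hm k).pow_const 2)]
      _ ≤ 2 * ∑' k, 2⁻¹ ^ k * ∫⁻ x, f x ^ 2 := by
          refine mul_le_mul_right (ENNReal.tsum_le_tsum fun k => ?_) 2
          calc _ ≤ (4 * B⁻¹ ^ 2) ^ k * (B ^ k * ∫⁻ x, f x ^ 2) :=
                mul_le_mul_right (strong_MMit hn f hf k) _
            _ = (4 * B⁻¹) ^ k * ∫⁻ x, f x ^ 2 := by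
                rw [← mul_assoc, ← mul_pow, pow_two, mul_assoc, mul_assoc,
                  ENNReal.inv_mul_cancel hB0 hBt, mul_one]
            _ ≤ _ := by
                refine mul_le_mul_left (pow_le_pow_left' ?_ k) _
                rw [← div_eq_mul_inv]
                calc 4 / B ≤ 4 / 8 := by gcongr
                  _ = 2⁻¹ := by
                    rw [show (8 : ℝ≥0∞) = 4 * 2 by norm_num, ← one_div,
                      ← ENNReal.mul_div_mul_left 1 2 (c := 4) (by norm_num) (by norm_num), mul_one]
      _ = _ := by
          rw [ENNReal.tsum_mul_right, hgeo, ← mul_assoc]; norm_num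

lemma rpow_mul_rpow_neg_le_one (y : ℝ≥0∞) (a : ℝ) : y ^ a * y ^ (-a) ≤ 1 := by
  rw [ENNReal.rpow_neg]
  exact ENNReal.mul_inv_le_one _

lemma cube_volume {n : ℕ} (c : Rn n) (h : ℝ) (hh : 0 < h) :
    volume (Set.univ.pi fun i => Set.Icc (c i) (c i + h)) = ENNReal.ofReal (h ^ n) := by
  rw [volume_pi_pi]
  simp [Real.volume_Icc, ENNReal.ofReal_pow hh.le]

lemma A1_of_MM {n : ℕ} (G : Rn n → ℝ≥0∞) (B : ℝ≥0∞) (hG : ∀ x, MM G x ≤ B * G x)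
    (Q : Set (Rn n)) (hQ : IsCube Q) (x : Rn n) (hx : x ∈ Q) :
    ∫⁻ y in Q, G y ≤ 4 ^ n * B * G x * volume Q := by
  obtain ⟨c, h, hh, rfl⟩ := hQ
  set Q := Set.univ.pi fun i => Set.Icc (c i) (c i + h)
  have hsub : Q ⊆ Metric.ball x (2 * h) := by
    intro y hy
    rw [Metric.mem_ball]
    refine lt_of_le_of_lt (b := h) ?_ (by linarith)
    rw [dist_pi_le_iff hh.le]
    intro i
    have h1 := hx i trivial
    have h2 := hy i trivial
    rw [Real.dist_eq, abs_le]
    constructor <;> linarith [h1.1, h1.2, h2.1, h2.2]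
  have hv : volume (Metric.ball x (2 * h)) = 4 ^ n * volume Q := by
    rw [Real.volume_pi_ball x (by positivity), Fintype.card_fin, cube_volume c h hh,
      show (2 * (2 * h)) ^ n = 4 ^ n * h ^ n by rw [← mul_pow]; ring,
      ENNReal.ofReal_mul (by positivity), ENNReal.ofReal_pow (by norm_num)]
    norm_num
  have hM : (∫⁻ y in Metric.ball x (2 * h), G y) / volume (Metric.ball x (2 * h)) ≤ MM G x :=
    le_iSup₂_of_le (f := fun (i : Rn n × ℝ) (_ : x ∈ Metric.ball i.1 i.2) =>
            (∫⁻ y in Metric.ball i.1 i.2, G y) / volume (Metric.ball i.1 i.2)) (x, 2 * h)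
            (Metric.mem_ball_self (by positivity)) le_rfl
  have hv0 : volume (Metric.ball x (2 * h)) ≠ 0 :=
    (Metric.measure_ball_pos _ _ (by positivity)).ne'
  calc ∫⁻ y in Q, G y ≤ ∫⁻ y in Metric.ball x (2 * h), G y := lintegral_mono_set hsub
    _ ≤ MM G x * volume (Metric.ball x (2 * h)) :=
        (ENNReal.div_le_iff hv0 measure_ball_lt_top.ne).1 hM
    _ ≤ B * G x * (4 ^ n * volume Q) := by rw [hv]; gcongr; exact hG x
    _ = _ := by ring

lemma jensen_neg {α : Type*} [MeasurableSpace α] (μ : Measure α) (G : α → ℝ≥0∞) (hG : Measurable G)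
    (hpos : ∀ x, 0 < G x) (hfin : ∫⁻ x, G x ∂μ ≠ ∞) (a : ℝ) (ha : 0 < a) :
    μ Set.univ ^ (1 + a) ≤ (∫⁻ x, G x ∂μ) ^ a * ∫⁻ x, G x ^ (-a) ∂μ := by
  have hc : ((1 + a) / a).HolderConjugate (1 + a) := by
    rw [Real.holderConjugate_iff]
    constructor
    · rw [lt_div_iff₀ ha]; linarith
    · field_simp; ring
  have h := ENNReal.lintegral_mul_le_Lp_mul_Lq μ hc (f := fun x => G x ^ (a / (1 + a)))
    (g := fun x => G x ^ (-(a / (1 + a)))) (by fun_prop) (by fun_prop)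
  have e1 : ∫⁻ x, ((fun x => G x ^ (a / (1 + a))) * fun x => G x ^ (-(a / (1 + a)))) x ∂μ
      = μ Set.univ := by
    rw [← lintegral_one]
    apply lintegral_congr_ae
    filter_upwards [ae_lt_top hG hfin] with x hx
    simp only [Pi.mul_apply]
    rw [← ENNReal.rpow_add _ _ (hpos x).ne' hx.ne]
    simp
  have e2 : ∀ x, (G x ^ (a / (1 + a))) ^ ((1 + a) / a) = G x := by
    intro x
    rw [← ENNReal.rpow_mul, show a / (1 + a) * ((1 + a) / a) = 1 by field_simp, ENNReal.rpow_one]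
  have e3 : ∀ x, (G x ^ (-(a / (1 + a)))) ^ (1 + a) = G x ^ (-a) := by
    intro x
    rw [← ENNReal.rpow_mul, show -(a / (1 + a)) * (1 + a) = -a by field_simp]
  rw [e1] at h
  simp only [e2, e3] at h
  calc _ ≤ _ := ENNReal.rpow_le_rpow h (by positivity)
    _ = _ := by
      rw [ENNReal.mul_rpow_of_nonneg _ _ (by positivity), ← ENNReal.rpow_mul, ← ENNReal.rpow_mul,
        show 1 / ((1 + a) / a) * (1 + a) = a by field_simp,
        show 1 / (1 + a) * (1 + a) = 1 by field_simp, ENNReal.rpow_one]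

lemma closedBall_isCube {n : ℕ} (x : Rn n) (r : ℝ) (hr : 0 < r) :
    IsCube (Metric.closedBall x r) := by
  refine ⟨fun i => x i - r, 2 * r, by positivity, ?_⟩
  rw [closedBall_pi _ hr.le]
  congr 1; ext i : 1
  rw [Real.closedBall_eq_Icc]
  congr 1; ring

lemma weight_RH {n : ℕ} (G : Rn n → ℝ≥0∞) (hG : Measurable G) (hpos : ∀ x, 0 < G x)
    (hfin : ∀ Q : Set (Rn n), IsCube Q → ∫⁻ x in Q, G x ≠ ∞) (K : ℝ≥0∞) (hK : K ≠ ∞)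
    (hA : ∀ Q : Set (Rn n), IsCube Q → ∀ x ∈ Q, ∫⁻ y in Q, G y ≤ K * G x * volume Q)
    (a : ℝ) (ha : 0 < a) :
    IsWeight (fun x => (G x ^ (-a)).toReal) ∧
      RHInftyWith (fun x => (G x ^ (-a)).toReal) (K ^ a).toReal := by
  have hnt : ∀ x, G x ^ (-a) ≠ ∞ := by
    intro x
    rw [ENNReal.rpow_neg, ENNReal.inv_ne_top]
    exact (ENNReal.rpow_pos_of_nonneg (hpos x) ha.le).ne'
  have hm : Measurable fun x => G x ^ (-a) := by fun_prop
  have cubeV : ∀ Q : Set (Rn n), IsCube Q → volume Q ≠ 0 ∧ volume Q ≠ ∞ ∧ MeasurableSet Q := by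
    rintro Q ⟨c, h, hh, rfl⟩
    refine ⟨?_, ?_, MeasurableSet.univ_pi fun i => measurableSet_Icc⟩
    · rw [cube_volume c h hh]; simp; positivity
    · rw [cube_volume c h hh]; simp
  have hI0 : ∀ Q : Set (Rn n), IsCube Q → ∫⁻ x in Q, G x ≠ 0 := by
    intro Q hQ h0
    rw [lintegral_eq_zero_iff hG] at h0
    have : volume.restrict Q Set.univ = 0 := by
      refine measure_mono_null (fun x _ => ?_) h0
      exact (hpos x).ne'
    simp at this
    exact (cubeV Q hQ).1 this
  -- pointwise bound
  have hbd : ∀ Q : Set (Rn n), IsCube Q → ∀ x ∈ Q,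
      G x ^ (-a) * (∫⁻ y in Q, G y) ^ a ≤ K ^ a * volume Q ^ a := by
    intro Q hQ x hx
    calc _ ≤ G x ^ (-a) * (K * G x * volume Q) ^ a := by gcongr; exact hA Q hQ x hx
      _ = (G x ^ a * G x ^ (-a)) * (K ^ a * volume Q ^ a) := by
          rw [ENNReal.mul_rpow_of_nonneg _ _ ha.le, ENNReal.mul_rpow_of_nonneg _ _ ha.le]; ring
      _ ≤ 1 * (K ^ a * volume Q ^ a) := by gcongr; exact rpow_mul_rpow_neg_le_one _ _
      _ = _ := one_mul _
  have hIa0 : ∀ Q : Set (Rn n), IsCube Q → (∫⁻ x in Q, G x) ^ a ≠ 0 := fun Q hQ =>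
    (ENNReal.rpow_pos_of_nonneg (pos_iff_ne_zero.2 (hI0 Q hQ)) ha.le).ne'
  have hIat : ∀ Q : Set (Rn n), IsCube Q → (∫⁻ x in Q, G x) ^ a ≠ ∞ := fun Q hQ =>
    ENNReal.rpow_ne_top_of_nonneg ha.le (hfin Q hQ)
  have hwfin : ∀ Q : Set (Rn n), IsCube Q → ∫⁻ x in Q, G x ^ (-a) ≠ ∞ := by
    intro Q hQ
    obtain ⟨v0, vt, vm⟩ := cubeV Q hQ
    have : ∫⁻ x in Q, G x ^ (-a) ≤ ∫⁻ x in Q, K ^ a * volume Q ^ a / (∫⁻ y in Q, G y) ^ a := by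
      apply setLIntegral_mono' vm
      intro x hx
      rw [ENNReal.le_div_iff_mul_le (Or.inl (hIa0 Q hQ)) (Or.inl (hIat Q hQ))]
      exact hbd Q hQ x hx
    refine ne_top_of_le_ne_top ?_ this
    rw [setLIntegral_const]
    refine ENNReal.mul_ne_top (ENNReal.div_ne_top (ENNReal.mul_ne_top ?_ ?_) (hIa0 Q hQ)) vt
    · exact ENNReal.rpow_ne_top_of_nonneg ha.le hK
    · exact ENNReal.rpow_ne_top_of_nonneg ha.le vt
  refine ⟨⟨fun x => ENNReal.toReal_nonneg, fun x => ?_⟩, fun Q hQ => ?_⟩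
  · refine ⟨Metric.closedBall x 1, Metric.closedBall_mem_nhds x one_pos, ?_⟩
    exact integrable_toReal_of_lintegral_ne_top hm.aemeasurable
      (hwfin _ (closedBall_isCube x 1 one_pos))
  · obtain ⟨v0, vt, vm⟩ := cubeV Q hQ
    have hK' : K ^ a ≠ ∞ := ENNReal.rpow_ne_top_of_nonneg ha.le hK
    have hR : ENNReal.ofReal ((K ^ a).toReal * cubeAvg Q (fun x => (G x ^ (-a)).toReal)) =
        K ^ a * ((volume Q)⁻¹ * ∫⁻ x in Q, G x ^ (-a)) := by
      rw [cubeAvg, integral_toReal hm.aemeasurable (Eventually.of_forall fun x => (hnt x).lt_top),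
        ← ENNReal.toReal_inv, ← ENNReal.toReal_mul, ← ENNReal.toReal_mul, ENNReal.ofReal_toReal]
      exact ENNReal.mul_ne_top hK' (ENNReal.mul_ne_top (ENNReal.inv_ne_top.2 v0) (hwfin Q hQ))
    rw [hR]
    refine essSup_le_of_ae_le _ ?_
    filter_upwards [ae_restrict_mem vm] with x hx
    simp only [ENNReal.ofReal_toReal (hnt x)]
    have hJ := jensen_neg (volume.restrict Q) G hG hpos (hfin Q hQ) a ha
    rw [Measure.restrict_apply_univ, ENNReal.rpow_add _ _ v0 vt, ENNReal.rpow_one] at hJ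
    have h1 := hbd Q hQ x hx
    -- multiply by the volume and cancel
    have h2 : (volume Q * (∫⁻ y in Q, G y) ^ a) * G x ^ (-a) ≤
        (volume Q * (∫⁻ y in Q, G y) ^ a) *
          (K ^ a * ((volume Q)⁻¹ * ∫⁻ x in Q, G x ^ (-a))) := by
      calc _ = volume Q * (G x ^ (-a) * (∫⁻ y in Q, G y) ^ a) := by ring
        _ ≤ volume Q * (K ^ a * volume Q ^ a) := by gcongr
        _ = K ^ a * (volume Q * volume Q ^ a) := by ring
        _ ≤ K ^ a * ((∫⁻ y in Q, G y) ^ a * ∫⁻ x in Q, G x ^ (-a)) := by gcongr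
        _ = (volume Q * (volume Q)⁻¹) *
            (K ^ a * ((∫⁻ y in Q, G y) ^ a * ∫⁻ x in Q, G x ^ (-a))) := by
            rw [ENNReal.mul_inv_cancel v0 vt, one_mul]
        _ = _ := by ring
    exact (ENNReal.mul_le_mul_iff_right (mul_ne_zero v0 (hIa0 Q hQ))
      (ENNReal.mul_ne_top vt (hIat Q hQ))).1 h2

lemma pos_of_MM {n : ℕ} (G : Rn n → ℝ≥0∞) (hG : Measurable G) (B : ℝ≥0∞)
    (hA : ∀ x, MM G x ≤ B * G x) (h0 : ∫⁻ x, G x ^ 2 ≠ 0) (x : Rn n) : 0 < G x := by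
  by_contra hx
  have hx : G x = 0 := by simpa using hx
  have hMx : MM G x = 0 := by simpa [hx] using hA x
  apply h0
  rw [lintegral_eq_zero_iff (hG.pow_const 2)]
  have hb : ∀ m : ℕ, ∀ᵐ y ∂volume.restrict (Metric.ball x m), G y = 0 := by
    intro m
    rcases Nat.eq_zero_or_pos m with rfl | hm
    · simp
    have hm' : (0 : ℝ) < m := by exact_mod_cast hm
    have h1 : (∫⁻ y in Metric.ball x m, G y) / volume (Metric.ball x (m : ℝ)) ≤ MM G x :=
      le_iSup₂_of_le (f := fun (i : Rn n × ℝ) (_ : x ∈ Metric.ball i.1 i.2) =>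
            (∫⁻ y in Metric.ball i.1 i.2, G y) / volume (Metric.ball i.1 i.2)) (x, (m : ℝ))
            (Metric.mem_ball_self hm') le_rfl
    rw [hMx, nonpos_iff_eq_zero, ENNReal.div_eq_zero_iff] at h1
    have h2 := h1.resolve_right measure_ball_lt_top.ne
    rw [lintegral_eq_zero_iff hG] at h2
    exact h2
  have h3 : ∀ᵐ y ∂volume.restrict (⋃ m : ℕ, Metric.ball x (m : ℝ)), G y = 0 :=
    (ae_restrict_iUnion_iff _ _).2 hb
  rw [Metric.iUnion_ball_nat, Measure.restrict_univ] at h3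
  filter_upwards [h3] with y hy
  simp [hy]

/-- Pointwise bound for the weighted integrand. -/
lemma pt_bound (φ F y : ℝ≥0∞) (p p₀ : ℝ) (hp : 0 < p) (hpp : p < p₀) (hF0 : F ≠ 0) (hFt : F ≠ ∞)
    (h : (φ / F) ^ (p / 2) ≤ y) :
    φ ^ p₀ * y ^ (-(2 * (p₀ - p) / p)) ≤ F ^ (p₀ - p) * φ ^ p := by
  have h1 : φ ≤ F * y ^ (2 / p) := by
    have := ENNReal.rpow_le_rpow h (show 0 ≤ 2 / p by positivity)
    rw [← ENNReal.rpow_mul, show p / 2 * (2 / p) = 1 by field_simp, ENNReal.rpow_one,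
      ENNReal.div_le_iff hF0 hFt, mul_comm] at this
    exact this
  have hd : 0 ≤ p₀ - p := by linarith
  have h2 : φ ^ (p₀ - p) ≤ F ^ (p₀ - p) * y ^ (2 * (p₀ - p) / p) := by
    calc _ ≤ (F * y ^ (2 / p)) ^ (p₀ - p) := ENNReal.rpow_le_rpow h1 hd
      _ = _ := by
        rw [ENNReal.mul_rpow_of_nonneg _ _ hd, ← ENNReal.rpow_mul]
        congr 2; ring
  calc φ ^ p₀ * y ^ (-(2 * (p₀ - p) / p))
      = φ ^ p * φ ^ (p₀ - p) * y ^ (-(2 * (p₀ - p) / p)) := by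
        rw [← ENNReal.rpow_add_of_nonneg _ _ hp.le hd]; congr 2; ring
    _ ≤ φ ^ p * (F ^ (p₀ - p) * y ^ (2 * (p₀ - p) / p)) * y ^ (-(2 * (p₀ - p) / p)) := by gcongr
    _ = F ^ (p₀ - p) * φ ^ p * (y ^ (2 * (p₀ - p) / p) * y ^ (-(2 * (p₀ - p) / p))) := by ring
    _ ≤ F ^ (p₀ - p) * φ ^ p * 1 := by gcongr; exact rpow_mul_rpow_neg_le_one _ _
    _ = _ := mul_one _

lemma int_bound {n : ℕ} (φ G : Rn n → ℝ≥0∞) (F : ℝ≥0∞) (p p₀ : ℝ) (hp : 0 < p) (hpp : p < p₀)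
    (hF0 : F ≠ 0) (hFt : F ≠ ∞) (h : ∀ x, (φ x / F) ^ (p / 2) ≤ G x)
    (hI : ∫⁻ x, φ x ^ p ≤ F ^ p) :
    ∫⁻ x, φ x ^ p₀ * G x ^ (-(2 * (p₀ - p) / p)) ≤ F ^ p₀ := by
  calc _ ≤ ∫⁻ x, F ^ (p₀ - p) * φ x ^ p :=
        lintegral_mono fun x => pt_bound _ _ _ p p₀ hp hpp hF0 hFt (h x)
    _ = F ^ (p₀ - p) * ∫⁻ x, φ x ^ p :=
        lintegral_const_mul' _ _ (ENNReal.rpow_ne_top_of_nonneg (by linarith) hFt)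
    _ ≤ F ^ (p₀ - p) * F ^ p := by gcongr
    _ = F ^ p₀ := by
        rw [← ENNReal.rpow_add _ _ hF0 hFt]; congr 1; ring

lemma holder_bound {n : ℕ} (φ G : Rn n → ℝ≥0∞) (hφ : Measurable φ) (hG : Measurable G)
    (p p₀ : ℝ) (hp : 0 < p) (hpp : p < p₀) (hpos : ∀ x, 0 < G x) (hfin : ∫⁻ x, G x ^ 2 ≠ ∞) :
    ∫⁻ x, φ x ^ p ≤ (∫⁻ x, φ x ^ p₀ * G x ^ (-(2 * (p₀ - p) / p))) ^ (p / p₀) *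
      (∫⁻ x, G x ^ 2) ^ (1 - p / p₀) := by
  have hp₀ : 0 < p₀ := hp.trans hpp
  have hd : 0 < p₀ - p := by linarith
  have hc : (p₀ / p).HolderConjugate (p₀ / (p₀ - p)) := by
    rw [Real.holderConjugate_iff]
    constructor
    · rw [lt_div_iff₀ hp]; linarith
    · field_simp; ring
  set a := 2 * (p₀ - p) / p with ha
  have h := ENNReal.lintegral_mul_le_Lp_mul_Lq volume hc
    (f := fun x => (φ x ^ p₀ * G x ^ (-a)) ^ (p / p₀))
    (g := fun x => (G x ^ 2) ^ ((p₀ - p) / p₀)) (by fun_prop) (by fun_prop)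
  have e1 : ∫⁻ x, φ x ^ p = ∫⁻ x, ((fun x => (φ x ^ p₀ * G x ^ (-a)) ^ (p / p₀)) *
      (fun x => (G x ^ 2) ^ ((p₀ - p) / p₀))) x := by
    apply lintegral_congr_ae
    filter_upwards [ae_lt_top (hG.pow_const 2) hfin] with x hx
    have hx' : G x ≠ ∞ := by
      intro h; simp [h] at hx
    simp only [Pi.mul_apply]
    rw [ENNReal.mul_rpow_of_nonneg _ _ (by positivity), ← ENNReal.rpow_mul, ← ENNReal.rpow_mul,
      ← ENNReal.rpow_natCast, ← ENNReal.rpow_mul, mul_assoc,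
      ← ENNReal.rpow_add _ _ (hpos x).ne' hx',
      show p₀ * (p / p₀) = p by field_simp,
      show -a * (p / p₀) + ((2 : ℕ) : ℝ) * ((p₀ - p) / p₀) = 0 by
        rw [ha]; push_cast; field_simp; ring]
    simp
  rw [← e1] at h
  refine h.trans (le_of_eq ?_)
  congr 1
  · rw [one_div_div]
    congr 1
    apply lintegral_congr; intro x
    rw [← ENNReal.rpow_mul, show p / p₀ * (p₀ / p) = 1 by field_simp, ENNReal.rpow_one]
  · rw [one_div_div, show (p₀ - p) / p₀ = 1 - p / p₀ by field_simp]
    congr 1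
    apply lintegral_congr; intro x
    rw [← ENNReal.rpow_mul, show (1 - p / p₀) * (p₀ / (p₀ - p)) = 1 by field_simp,
      ENNReal.rpow_one]

/-- Construction of the weight. -/
lemma exists_weight {n : ℕ} (hn : 1 ≤ n) (φ γ : Rn n → ℝ≥0∞) (hφ : Measurable φ)
    (hγ : Measurable γ) (p p₀ : ℝ) (hp : 0 < p) (hpp : p < p₀) (F D : ℝ≥0∞)
    (hF0 : F ≠ 0) (hFt : F ≠ ∞) (hD0 : D ≠ 0) (hDt : D ≠ ∞)
    (hφF : ∫⁻ x, φ x ^ p = F ^ p) (hγD : ∫⁻ x, γ x ^ p ≤ D ^ p) :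
    ∃ w : Rn n → ℝ, IsWeight w ∧
      RHInftyWith w ((4 ^ n * (8 * 5 ^ n) : ℝ≥0∞) ^ (2 * (p₀ - p) / p)).toReal ∧
      ∫⁻ x, φ x ^ p₀ * ENNReal.ofReal (w x) ≤ F ^ p₀ ∧
      ∫⁻ x, γ x ^ p₀ * ENNReal.ofReal (w x) ≤ D ^ p₀ ∧
      F ^ p ≤ (∫⁻ x, φ x ^ p₀ * ENNReal.ofReal (w x)) ^ (p / p₀) * 8 ^ (1 - p / p₀) := by
  have hp₀ : 0 < p₀ := hp.trans hpp
  have hd : 0 < p₀ - p := by linarith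
  set k : Rn n → ℝ≥0∞ := fun x => max ((φ x / F) ^ (p / 2)) ((γ x / D) ^ (p / 2)) with hk
  have hkm : Measurable k := by fun_prop
  have sqe : ∀ y : ℝ≥0∞, (y ^ (p / 2)) ^ 2 = y ^ p := by
    intro y
    rw [← ENNReal.rpow_natCast, ← ENNReal.rpow_mul]; congr 1; push_cast; ring
  have nrm : ∀ (ψ : Rn n → ℝ≥0∞) (E : ℝ≥0∞), Measurable ψ → E ≠ 0 → E ≠ ∞ →
      ∫⁻ x, (ψ x / E) ^ p = (∫⁻ x, ψ x ^ p) / E ^ p := by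
    intro ψ E hψ h0 ht
    simp only [ENNReal.div_rpow_of_nonneg _ _ hp.le]
    simp only [div_eq_mul_inv]
    rw [lintegral_mul_const _ (by fun_prop)]
  have hFp0 : F ^ p ≠ 0 := (ENNReal.rpow_pos (pos_iff_ne_zero.2 hF0) hFt).ne'
  have hFpt : F ^ p ≠ ∞ := ENNReal.rpow_ne_top_of_nonneg hp.le hFt
  have hDp0 : D ^ p ≠ 0 := (ENNReal.rpow_pos (pos_iff_ne_zero.2 hD0) hDt).ne'
  have hDpt : D ^ p ≠ ∞ := ENNReal.rpow_ne_top_of_nonneg hp.le hDt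
  have n1 : ∫⁻ x, (φ x / F) ^ p = 1 := by
    rw [nrm φ F hφ hF0 hFt, hφF, ENNReal.div_self hFp0 hFpt]
  have n2 : ∫⁻ x, (γ x / D) ^ p ≤ 1 := by
    rw [nrm γ D hγ hD0 hDt]
    exact ENNReal.div_le_of_le_mul (by rwa [one_mul])
  have hk2 : ∫⁻ x, k x ^ 2 ≤ 2 := by
    calc ∫⁻ x, k x ^ 2 ≤ ∫⁻ x, ((φ x / F) ^ p + (γ x / D) ^ p) := by
          apply lintegral_mono; intro x
          simp only [hk]
          rcases le_total ((φ x / F) ^ (p / 2)) ((γ x / D) ^ (p / 2)) with h | h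
          · rw [max_eq_right h, sqe]; exact le_add_self
          · rw [max_eq_left h, sqe]; exact le_self_add
      _ = (∫⁻ x, (φ x / F) ^ p) + ∫⁻ x, (γ x / D) ^ p := lintegral_add_left (by fun_prop) _
      _ ≤ 1 + 1 := by rw [n1]; gcongr
      _ = 2 := by norm_num
  obtain ⟨G, hGm, hkG, hGA, hG2⟩ := exists_rdf hn k hkm
  have hG8 : ∫⁻ x, G x ^ 2 ≤ 8 := by
    calc _ ≤ 4 * ∫⁻ x, k x ^ 2 := hG2
      _ ≤ 4 * 2 := by gcongr
      _ = 8 := by norm_num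
  have hG2t : ∫⁻ x, G x ^ 2 ≠ ∞ := ne_top_of_le_ne_top (by norm_num) hG8
  have hGφ : ∀ x, (φ x / F) ^ (p / 2) ≤ G x := fun x => (le_max_left _ _).trans (hkG x)
  have hGγ : ∀ x, (γ x / D) ^ (p / 2) ≤ G x := fun x => (le_max_right _ _).trans (hkG x)
  have hG20 : ∫⁻ x, G x ^ 2 ≠ 0 := by
    have : 1 ≤ ∫⁻ x, G x ^ 2 := by
      rw [← n1]
      apply lintegral_mono; intro x
      simp only [← sqe]
      exact pow_le_pow_left' (hGφ x) 2
    exact (lt_of_lt_of_le one_pos this).ne'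
  have hpos := pos_of_MM G hGm _ hGA hG20
  have hfin : ∀ Q : Set (Rn n), IsCube Q → ∫⁻ x in Q, G x ≠ ∞ := by
    rintro Q ⟨c, h, hh, rfl⟩
    set Q := Set.univ.pi fun i => Set.Icc (c i) (c i + h)
    have hv : volume Q ≠ ∞ := by rw [cube_volume c h hh]; simp
    have : ∫⁻ x in Q, G x ≤ volume Q + ∫⁻ x, G x ^ 2 := by
      calc _ ≤ ∫⁻ x in Q, (1 + G x ^ 2) := by
            apply lintegral_mono; intro x
            rcases le_total (G x) 1 with h | h
            · exact h.trans le_self_add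
            · exact (le_self_pow₀ h (by norm_num)).trans le_add_self
        _ = volume Q + ∫⁻ x in Q, G x ^ 2 := by
            rw [lintegral_add_left measurable_const, setLIntegral_const, one_mul]
        _ ≤ _ := add_le_add_right (setLIntegral_le_lintegral _ _) _
    exact ne_top_of_le_ne_top (ENNReal.add_ne_top.2 ⟨hv, hG2t⟩) this
  have ha : 0 < 2 * (p₀ - p) / p := by positivity
  obtain ⟨hw, hRH⟩ := weight_RH G hGm hpos hfin (4 ^ n * (8 * 5 ^ n))
    (ENNReal.mul_ne_top (by simp) (ENNReal.mul_ne_top (by norm_num) (by simp)))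
    (fun Q hQ x hx => A1_of_MM G _ hGA Q hQ x hx) (2 * (p₀ - p) / p) ha
  have hnt : ∀ x, ENNReal.ofReal ((G x ^ (-(2 * (p₀ - p) / p))).toReal) =
      G x ^ (-(2 * (p₀ - p) / p)) := by
    intro x
    apply ENNReal.ofReal_toReal
    rw [ENNReal.rpow_neg, ENNReal.inv_ne_top]
    exact (ENNReal.rpow_pos_of_nonneg (hpos x) ha.le).ne'
  refine ⟨_, hw, hRH, ?_, ?_, ?_⟩
  · simp only [hnt]
    exact int_bound φ G F p p₀ hp hpp hF0 hFt hGφ hφF.le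
  · simp only [hnt]
    exact int_bound γ G D p p₀ hp hpp hD0 hDt hGγ hγD
  · simp only [hnt]
    rw [← hφF]
    refine (holder_bound φ G hφ hGm p p₀ hp hpp hpos hG2t).trans ?_
    gcongr
    rw [sub_nonneg, div_le_one hp₀]
    exact hpp.le

lemma lpNorm_eq {n : ℕ} (p : ℝ) (hp : 0 < p) (w f : Rn n → ℝ) (hf : ∀ x, 0 ≤ f x) :
    lpNorm p w f = (∫⁻ x, ENNReal.ofReal (f x) ^ p * ENNReal.ofReal (w x)) ^ (1 / p) := by
  unfold _root_.lpNorm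
  congr 1
  apply lintegral_congr; intro x
  rw [abs_of_nonneg (hf x), ENNReal.ofReal_mul (Real.rpow_nonneg (hf x) p),
    ENNReal.ofReal_rpow_of_nonneg (hf x) hp.le]

lemma one_RH {n : ℕ} : RHInftyWith (fun _ : Rn n => (1 : ℝ)) 1 := by
  rintro Q ⟨c, h, hh, rfl⟩
  have hv := cube_volume c h hh
  set Q := Set.univ.pi fun i => Set.Icc (c i) (c i + h)
  have h1 : cubeAvg Q (fun _ : Rn n => (1 : ℝ)) = 1 := by
    have : (volume Q).toReal ≠ 0 := by
      rw [hv, ENNReal.toReal_ofReal (by positivity)]; positivity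
    unfold cubeAvg
    rw [setIntegral_const, smul_eq_mul, mul_one, measureReal_def, inv_mul_cancel₀ this]
  rw [h1]
  refine essSup_le_of_ae_le _ (Eventually.of_forall fun x => ?_)
  simp

/-- Theorem 3.4, case `p₀ = q₀`: unweighted conclusions from
`RH_∞` extrapolation. -/
theorem statement4 {n : ℕ} (hn : 1 ≤ n) (p₀ : ℝ) (hp₀ : 0 < p₀)
    (𝓕 : Set ((Rn n → ℝ) × (Rn n → ℝ)))
    (h𝓕 : ∀ fg ∈ 𝓕, Measurable fg.1 ∧ Measurable fg.2 ∧
      (∀ x, 0 ≤ fg.1 x) ∧ (∀ x, 0 ≤ fg.2 x))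
    (N : ℝ → ℝ) (hNpos : ∀ c > 0, 0 < N c) (hNmono : MonotoneOn N (Set.Ioi 0))
    (hyp : ∀ c : ℝ, 0 < c → ∀ w : Rn n → ℝ, IsWeight w → RHInftyWith w c →
      ∀ fg ∈ 𝓕, lpNorm p₀ w fg.1 < ⊤ →
        lpNorm p₀ w fg.1 ≤ ENNReal.ofReal (N c) * lpNorm p₀ w fg.2) :
    ∀ p : ℝ, 0 < p → p ≤ p₀ →
      ∃ C : ℝ, 0 < C ∧ ∀ fg ∈ 𝓕, lpNorm p (fun _ => (1 : ℝ)) fg.1 < ⊤ →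
        lpNorm p (fun _ => (1 : ℝ)) fg.1
          ≤ ENNReal.ofReal C * lpNorm p (fun _ => (1 : ℝ)) fg.2 := by
  intro p hp hpp
  rcases hpp.eq_or_lt with rfl | hlt
  · refine ⟨N 1, hNpos 1 one_pos, fun fg hfg hfin => ?_⟩
    refine hyp 1 one_pos _ ⟨fun _ => zero_le_one, ?_⟩ one_RH fg hfg hfin
    exact locallyIntegrable_const 1
  · have ha : 0 < 2 * (p₀ - p) / p := by
      have : 0 < p₀ - p := by linarith
      positivity
    set c : ℝ := ((4 ^ n * (8 * 5 ^ n) : ℝ≥0∞) ^ (2 * (p₀ - p) / p)).toReal with hc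
    have hcpos : 0 < c := by
      have hK : (4 ^ n * (8 * 5 ^ n) : ℝ≥0∞) ≠ ∞ :=
        ENNReal.mul_ne_top (by simp) (ENNReal.mul_ne_top (by norm_num) (by simp))
      apply ENNReal.toReal_pos
      · exact (ENNReal.rpow_pos (by positivity) hK).ne'
      · exact ENNReal.rpow_ne_top_of_nonneg ha.le hK
    have hNc := hNpos c hcpos
    set e : ℝ := (1 - p / p₀) * (1 / p) with he
    have he0 : 0 ≤ e := by
      have : p / p₀ ≤ 1 := (div_le_one hp₀).2 hpp
      have h1 : 0 ≤ 1 - p / p₀ := by linarith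
      positivity
    refine ⟨N c * 8 ^ e, by positivity, fun fg hfg hfin => ?_⟩
    obtain ⟨hfm, hgm, hf0, hg0⟩ := h𝓕 fg hfg
    have h1 : ∀ f : Rn n → ℝ, (∀ x, 0 ≤ f x) → lpNorm p (fun _ => (1 : ℝ)) f =
        (∫⁻ x, ENNReal.ofReal (f x) ^ p) ^ (1 / p) := by
      intro f hf
      rw [lpNorm_eq p hp _ f hf]; simp
    have h2 : ∀ f : Rn n → ℝ, (∀ x, 0 ≤ f x) → ∫⁻ x, ENNReal.ofReal (f x) ^ p =
        lpNorm p (fun _ => (1 : ℝ)) f ^ p := by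
      intro f hf
      rw [h1 f hf, ← ENNReal.rpow_mul, one_div_mul_cancel hp.ne', ENNReal.rpow_one]
    set F := lpNorm p (fun _ => (1 : ℝ)) fg.1 with hF
    set D₀ := lpNorm p (fun _ => (1 : ℝ)) fg.2 with hD₀
    by_cases hF0 : F = 0
    · rw [hF0]; exact zero_le
    have hCe : ENNReal.ofReal (N c * 8 ^ e) = ENNReal.ofReal (N c) * 8 ^ e := by
      rw [ENNReal.ofReal_mul hNc.le, ← ENNReal.ofReal_rpow_of_pos (by norm_num)]
      norm_num
    have hCpos : ENNReal.ofReal (N c * 8 ^ e) ≠ 0 := by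
      simp only [ne_eq, ENNReal.ofReal_eq_zero, not_le]; positivity
    rw [mul_comm, ← ENNReal.div_le_iff hCpos ENNReal.ofReal_ne_top]
    refine le_of_forall_gt_imp_ge_of_dense fun D hD => ?_
    by_cases hDt : D = ∞
    · rw [hDt]; exact le_top
    rw [ENNReal.div_le_iff hCpos ENNReal.ofReal_ne_top]
    have hD0 : D ≠ 0 := (lt_of_le_of_lt zero_le hD).ne'
    obtain ⟨w, hw, hRH, hI1, hI2, hI3⟩ := exists_weight hn (fun x => ENNReal.ofReal (fg.1 x))
      (fun x => ENNReal.ofReal (fg.2 x)) (by fun_prop) (by fun_prop) p p₀ hp hlt F D hF0 hfin.ne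
      hD0 hDt (h2 _ hf0) (by rw [h2 _ hg0]; exact ENNReal.rpow_le_rpow hD.le hp.le)
    have hfw := lpNorm_eq p₀ hp₀ w fg.1 hf0
    have hgw := lpNorm_eq p₀ hp₀ w fg.2 hg0
    have hq : 0 ≤ 1 / p₀ := by positivity
    have hcanc : ∀ E : ℝ≥0∞, (E ^ p₀) ^ (1 / p₀) = E := by
      intro E
      rw [← ENNReal.rpow_mul, mul_one_div_cancel hp₀.ne', ENNReal.rpow_one]
    have hb := hyp c hcpos w hw hRH fg hfg (by
      rw [hfw]
      refine lt_of_le_of_lt (ENNReal.rpow_le_rpow hI1 hq) ?_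
      rw [hcanc]; exact hfin)
    have hgD : lpNorm p₀ w fg.2 ≤ D := by
      rw [hgw, ← hcanc D]
      exact ENNReal.rpow_le_rpow hI2 hq
    have hfin3 : F ≤ lpNorm p₀ w fg.1 * 8 ^ e := by
      have := ENNReal.rpow_le_rpow hI3 (show 0 ≤ 1 / p by positivity)
      rw [← ENNReal.rpow_mul, mul_one_div_cancel hp.ne', ENNReal.rpow_one,
        ENNReal.mul_rpow_of_nonneg _ _ (by positivity), ← ENNReal.rpow_mul, ← ENNReal.rpow_mul,
        show p / p₀ * (1 / p) = 1 / p₀ by field_simp, ← hfw] at this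
      exact this
    calc F ≤ lpNorm p₀ w fg.1 * 8 ^ e := hfin3
      _ ≤ (ENNReal.ofReal (N c) * D) * 8 ^ e := by
          gcongr
          exact hb.trans (by gcongr)
      _ = _ := by rw [hCe]; ring
end
end

section
/- Let Ψ be a Young function, let 0 < θ < 1, and suppose C(t) := Ψ(t^{1/θ}) is also a Young function. If w is a weight on ℝⁿ in the generalized reverse Hölder class RH_Ψ, then w^θ ∈ RH_C; that is, sup_Q (⨍_Q w^θ dx)⁻¹ ‖w^θ‖_{C,Q} < ∞, the supremum over all cubes Q. -/
open MeasureTheory Filter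
open scoped ENNReal Classical

noncomputable section

theorem orlicz_scale {n : ℕ} (Ψ C : ℝ → ℝ) (θ : ℝ) (hθ0 : 0 < θ)
    (hCdef : ∀ t : ℝ, 0 ≤ t → C t = Ψ (t ^ (1 / θ)))
    (w : Rn n → ℝ) (hw : ∀ x, 0 ≤ w x) (Q : Set (Rn n)) :
    orliczNorm C (fun x => w x ^ θ) Q ≤ (orliczNorm Ψ w Q) ^ θ := by
  have key : ∀ l : ℝ, 0 < l → (fun x => C (|w x ^ θ| / l ^ θ)) = fun x => Ψ (|w x| / l) := by
    intro l hl
    funext x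
    have h1 : 0 ≤ w x ^ θ := Real.rpow_nonneg (hw x) _
    rw [abs_of_nonneg h1, abs_of_nonneg (hw x), ← Real.div_rpow (hw x) hl.le,
      hCdef _ (Real.rpow_nonneg (div_nonneg (hw x) hl.le) _), one_div,
      Real.rpow_rpow_inv (div_nonneg (hw x) hl.le) hθ0.ne']
  have hnn : 0 ≤ orliczNorm C (fun x => w x ^ θ) Q :=
    Real.sInf_nonneg (fun l hl => hl.1.le)
  have hnn' : 0 ≤ orliczNorm Ψ w Q := Real.sInf_nonneg (fun l hl => hl.1.le)
  by_cases hne : {lam : ℝ | 0 < lam ∧ cubeAvg Q (fun x => Ψ (|w x| / lam)) ≤ 1}.Nonempty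
  · have : (orliczNorm C (fun x => w x ^ θ) Q) ^ (θ⁻¹) ≤ orliczNorm Ψ w Q := by
      apply le_csInf hne
      rintro l ⟨hl, hl'⟩
      have : orliczNorm C (fun x => w x ^ θ) Q ≤ l ^ θ := by
        apply csInf_le ⟨0, fun l hl => hl.1.le⟩
        refine ⟨Real.rpow_pos_of_pos hl _, ?_⟩
        rw [key l hl]; exact hl'
      calc _ ≤ (l ^ θ) ^ θ⁻¹ := Real.rpow_le_rpow hnn this (by positivity)
        _ = l := Real.rpow_rpow_inv hl.le hθ0.ne'
    calc orliczNorm C (fun x => w x ^ θ) Q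
        = ((orliczNorm C (fun x => w x ^ θ) Q) ^ (θ⁻¹)) ^ θ :=
          (Real.rpow_inv_rpow hnn hθ0.ne').symm
      _ ≤ _ := Real.rpow_le_rpow (Real.rpow_nonneg hnn _) this hθ0.le
  · have : {lam : ℝ | 0 < lam ∧ cubeAvg Q (fun x => C (|w x ^ θ| / lam)) ≤ 1} = ∅ := by
      rw [Set.eq_empty_iff_forall_notMem]
      rintro l ⟨hl, hl'⟩
      apply hne
      refine ⟨l ^ θ⁻¹, Real.rpow_pos_of_pos hl _, ?_⟩
      rw [← key _ (Real.rpow_pos_of_pos hl _), Real.rpow_inv_rpow hl.le hθ0.ne']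
      exact hl'
    have h0 : orliczNorm C (fun x => w x ^ θ) Q = 0 := by
      unfold orliczNorm; rw [this]; exact Real.sInf_empty
    rw [h0]; exact Real.rpow_nonneg hnn' _

theorem orlicz_good {n : ℕ} (Ψ : ℝ → ℝ) (hΨ : IsYoung Ψ)
    (w : Rn n → ℝ) (Q : Set (Rn n))
    (hwi : IntegrableOn w Q) (hN : 0 < orliczNorm Ψ w Q) :
    ∃ l : ℝ, 0 < l ∧ l ≤ 2 * orliczNorm Ψ w Q ∧ IntegrableOn (fun x => Ψ (|w x| / l)) Q ∧
      cubeAvg Q (fun x => Ψ (|w x| / l)) ≤ 1 := by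
  obtain ⟨_, hmono, hcont, hzero, _⟩ := hΨ
  have hne : {lam : ℝ | 0 < lam ∧ cubeAvg Q (fun x => Ψ (|w x| / lam)) ≤ 1}.Nonempty := by
    by_contra h
    rw [Set.not_nonempty_iff_eq_empty] at h
    unfold orliczNorm at hN
    rw [h, Real.sInf_empty] at hN
    exact lt_irrefl _ hN
  obtain ⟨l, ⟨hl, hl'⟩, hlt⟩ := exists_lt_of_csInf_lt hne
    (show sInf _ < 2 * orliczNorm Ψ w Q by change orliczNorm Ψ w Q < _; linarith)
  have hbdd : BddBelow {lam : ℝ | 0 < lam ∧ cubeAvg Q (fun x => Ψ (|w x| / lam)) ≤ 1} :=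
    ⟨0, fun l hl => hl.1.le⟩
  have hNl : orliczNorm Ψ w Q ≤ l := csInf_le hbdd ⟨hl, hl'⟩
  refine ⟨l, hl, hlt.le, ?_, hl'⟩
  set N := orliczNorm Ψ w Q with hNdef
  have hint : IntegrableOn (fun x => Ψ (|w x| / (N / 2))) Q := by
    by_contra h
    have : N ≤ N / 2 := by
      apply csInf_le hbdd
      refine ⟨by linarith, ?_⟩
      unfold cubeAvg
      rw [integral_undef h]; simp
    linarith
  have hpos : ∀ t, 0 ≤ t → 0 ≤ Ψ t := fun t ht => by
    rw [← hzero]; exact hmono.monotoneOn (Set.mem_Ici.2 le_rfl) ht ht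
  refine Integrable.mono hint ?_ ?_
  · have hc : Continuous (fun t => Ψ (max t 0)) :=
      hcont.comp_continuous (by fun_prop) (fun t => Set.mem_Ici.2 (le_max_right _ _))
    have hm : AEStronglyMeasurable (fun x => |w x| / l) (volume.restrict Q) := by
      have := hwi.aestronglyMeasurable.norm.mul_const l⁻¹
      simpa [div_eq_mul_inv] using this
    refine (hc.comp_aestronglyMeasurable hm).congr (Eventually.of_forall fun x => ?_)
    have : 0 ≤ |w x| / l := by positivity
    simp [max_eq_left this]
  · refine Eventually.of_forall fun x => ?_
    have h1 : 0 ≤ |w x| / l := by positivity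
    have h2 : 0 ≤ |w x| / (N / 2) := by positivity
    rw [Real.norm_of_nonneg (hpos _ h1), Real.norm_of_nonneg (hpos _ h2)]
    apply hmono.monotoneOn h1 h2
    apply div_le_div_of_nonneg_left (abs_nonneg _) (by linarith) (by linarith)

/-- rescaling of generalized reverse Hölder classes:
`w ∈ RH_Ψ` implies `w^θ ∈ RH_C` for `C(t) = Ψ(t^{1/θ})`. -/
theorem statement17 {n : ℕ} (Ψ C : ℝ → ℝ) (θ : ℝ) (hθ0 : 0 < θ) (hθ1 : θ < 1)
    (hΨ : IsYoung Ψ) (hC : IsYoung C) (hCdef : ∀ t : ℝ, 0 ≤ t → C t = Ψ (t ^ (1 / θ)))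
    (w : Rn n → ℝ) (hw : IsWeight w) (hRH : RHOrlicz Ψ w) :
    RHOrlicz C fun x => w x ^ θ := by
  obtain ⟨c₀, hc₀⟩ := hRH
  obtain ⟨hw0, hwl⟩ := hw
  set c := max c₀ 1 with hcdef
  have hc : 0 < c := lt_of_lt_of_le one_pos (le_max_right _ _)
  have havg : ∀ (Q : Set (Rn n)) (f : Rn n → ℝ), (∀ x, 0 ≤ f x) → 0 ≤ cubeAvg Q f := fun Q f hf =>
    mul_nonneg (by positivity) (integral_nonneg hf)
  obtain ⟨T₀, hT₀⟩ := (hΨ.2.2.2.2.eventually_ge_atTop (4 * c)).exists_forall_of_atTop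
  set T := max T₀ 1 with hTdef
  have hT : 0 < T := lt_of_lt_of_le one_pos (le_max_right _ _)
  have hTΨ : ∀ t, T ≤ t → 4 * c * t ≤ Ψ t := fun t ht => by
    have h1 := hT₀ t ((le_max_left _ _).trans ht)
    rwa [le_div_iff₀ (hT.trans_le ht)] at h1
  have hpos : ∀ t, 0 ≤ t → 0 ≤ Ψ t := fun t ht => by
    rw [← hΨ.2.2.2.1]; exact hΨ.2.1.monotoneOn (Set.mem_Ici.2 le_rfl) ht ht
  refine ⟨c ^ θ * (2 * (2 * c * T) ^ (1 - θ)), fun Q hQ => ?_⟩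
  refine (orlicz_scale Ψ C θ hθ0 hCdef w hw0 Q).trans ?_
  have hB : 0 ≤ cubeAvg Q (fun x => w x ^ θ) := havg Q _ fun x => Real.rpow_nonneg (hw0 x) _
  have hA := havg Q w hw0
  have hN0 : 0 ≤ orliczNorm Ψ w Q := Real.sInf_nonneg (fun l hl => hl.1.le)
  have hNA : orliczNorm Ψ w Q ≤ c * cubeAvg Q w :=
    (hc₀ Q hQ).trans (mul_le_mul_of_nonneg_right (le_max_left _ _) hA)
  rcases hN0.eq_or_lt with h0 | hN
  · rw [← h0, Real.zero_rpow hθ0.ne']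
    positivity
  have hQc : IsCompact Q := by
    obtain ⟨a, h, _, rfl⟩ := hQ
    exact isCompact_univ_pi fun i => isCompact_Icc
  have hwi : IntegrableOn w Q := hwl.integrableOn_isCompact hQc
  obtain ⟨l, hl, hlN, hli, hl1⟩ := orlicz_good Ψ hΨ w Q hwi hN
  set A := cubeAvg Q w with hAdef
  set B := cubeAvg Q (fun x => w x ^ θ) with hBdef
  have hApos : 0 < A := by
    by_contra h
    have : A = 0 := le_antisymm (not_lt.1 h) hA
    rw [this] at hNA; linarith
  have hwθ : IntegrableOn (fun x => w x ^ θ) Q := by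
    have hfin : volume Q ≠ ⊤ := hQc.measure_lt_top.ne
    have h1 : IntegrableOn (fun x => 1 + w x) Q :=
      (integrableOn_const hfin).add hwi
    refine Integrable.mono h1
      ((Real.continuous_rpow_const hθ0.le).comp_aestronglyMeasurable hwi.aestronglyMeasurable) ?_
    refine Eventually.of_forall fun x => ?_
    rw [Real.norm_of_nonneg (Real.rpow_nonneg (hw0 x) _),
      Real.norm_of_nonneg (by linarith [hw0 x])]
    rcases le_total (w x) 1 with h | h
    · linarith [Real.rpow_le_one (hw0 x) h hθ0.le, hw0 x]
    · have := Real.rpow_le_rpow_of_exponent_le h hθ1.le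
      rw [Real.rpow_one] at this; linarith
  have hpt : ∀ x, w x ≤ (l * T) ^ (1 - θ) * w x ^ θ + l / (4 * c) * Ψ (|w x| / l) := by
    intro x
    rw [abs_of_nonneg (hw0 x)]
    have hx : 0 ≤ w x / l := div_nonneg (hw0 x) hl.le
    have p1 : 0 ≤ (l * T) ^ (1 - θ) * w x ^ θ :=
      mul_nonneg (by positivity) (Real.rpow_nonneg (hw0 x) _)
    have p2 : 0 ≤ l / (4 * c) * Ψ (w x / l) := mul_nonneg (by positivity) (hpos _ hx)
    rcases le_total (w x / l) T with h | h
    · have h' : w x ≤ l * T := by rwa [div_le_iff₀ hl, mul_comm] at h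
      have e : w x = w x ^ (1 - θ) * w x ^ θ := by
        rw [← Real.rpow_add' (hw0 x) (by norm_num)]; norm_num
      have := mul_le_mul_of_nonneg_right
        (Real.rpow_le_rpow (hw0 x) h' (by linarith : 0 ≤ 1 - θ)) (Real.rpow_nonneg (hw0 x) θ)
      linarith
    · have := mul_le_mul_of_nonneg_left (hTΨ _ h) (show 0 ≤ l / (4 * c) by positivity)
      have e : l / (4 * c) * (4 * c * (w x / l)) = w x := by field_simp
      linarith
  have hAB : A ≤ (l * T) ^ (1 - θ) * B + l / (4 * c) * cubeAvg Q (fun x => Ψ (|w x| / l)) := by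
    have h1 : ∫ x in Q, w x ≤ ∫ x in Q,
        ((l * T) ^ (1 - θ) * w x ^ θ + l / (4 * c) * Ψ (|w x| / l)) :=
      integral_mono hwi ((hwθ.const_mul _).add (hli.const_mul _)) hpt
    rw [integral_add (hwθ.const_mul _) (hli.const_mul _), integral_const_mul,
      integral_const_mul] at h1
    have h2 := mul_le_mul_of_nonneg_left h1 (show 0 ≤ (volume Q).toReal⁻¹ by positivity)
    rw [hAdef, hBdef]
    unfold cubeAvg
    linarith
  have hlA : l ≤ 2 * c * A := by linarith
  have h3 : l / (4 * c) * cubeAvg Q (fun x => Ψ (|w x| / l)) ≤ A / 2 := by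
    calc _ ≤ l / (4 * c) * 1 := mul_le_mul_of_nonneg_left hl1 (by positivity)
      _ ≤ A / 2 := by rw [mul_one, div_le_iff₀ (by positivity)]; linarith
  have h4 : (l * T) ^ (1 - θ) ≤ (2 * c * T) ^ (1 - θ) * A ^ (1 - θ) := by
    rw [← Real.mul_rpow (by positivity) hA]
    apply Real.rpow_le_rpow (by positivity) _ (by linarith)
    nlinarith
  have h5 : A ≤ 2 * (2 * c * T) ^ (1 - θ) * B * A ^ (1 - θ) := by
    have := mul_le_mul_of_nonneg_right h4 hB
    linarith
  have h6 : A ^ θ ≤ 2 * (2 * c * T) ^ (1 - θ) * B := by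
    have e : A = A ^ θ * A ^ (1 - θ) := by
      rw [← Real.rpow_add hApos]; norm_num
    have hp : 0 < A ^ (1 - θ) := Real.rpow_pos_of_pos hApos _
    refine le_of_mul_le_mul_right ?_ hp
    rw [← e]; exact h5
  calc orliczNorm Ψ w Q ^ θ ≤ (c * A) ^ θ := Real.rpow_le_rpow hN0 hNA hθ0.le
    _ = c ^ θ * A ^ θ := Real.mul_rpow hc.le hA
    _ ≤ c ^ θ * (2 * (2 * c * T) ^ (1 - θ) * B) := mul_le_mul_of_nonneg_left h6 (by positivity)
    _ = _ := by ring
end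
end
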